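/- For a finite set $L\subseteq\mathbb{Q}^d\subseteq\mathbb{R}^d$ and a weight function $w:L\to\mathbb{Q}_{\ge 0}$, let $Q_w:=\operatorname{conv}\{(x,w(x)) : x\in L\}\subseteq\mathbb{R}^d\times\mathbb{R}$ be the lifted polytope, and let $\pi:\mathbb{R}^d\times\mathbb{R}\to\mathbb{R}^d$ be the projection. A lower facet of $Q_w$ is a set of the form $\{z\in Q_w : u(z)=\min_{Q_w}u\}$, where $u$ is a linear functional on $\mathbb{R}^d\times\mathbb{R}$ with $u(0,1)>0$, whose dimension equals $\dim\operatorname{conv}(\pi(Q_w))=\dim\operatorname{conv}(L)$. The weight $w$ induces a regular triangulation of $L$ if every lower facet of $Q_w$ is a simplex (the convex hull of an affinely independent finite set); the simplices of this triangulation are the projections under $\pi$ of the lower facets of $Q_w$. Dimension means dimension of the affine hull, with $\dim\emptyset=-1$. Let $L_0\subseteq L\subseteq\mathbb{Q}^d$ be finite sets with $\dim\operatorname{conv}(L_0)=\dim\operatorname{conv}(L)$, and let $w_0:L_0\to\mathbb{Q}_{\ge 0}$ be a weight function such that every lower facet of $Q_{w_0}$ is a simplex (i.e., $w_0$ induces a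 regular triangulation of $L_0$). Then there exists a weight function $w:L\to\mathbb{Q}_{\ge 0}$ extending $w_0$ ($w(x)=w_0(x)$ for all $x\in L_0$) such that every lower facet of $Q_w$ is a simplex and every lower facet of $Q_{w_0}$ is also a lower facet of $Q_w$; in particular, every simplex of the regular triangulation of $L_0$ induced by $w_0$ is a simplex of the regular triangulation of $L$ induced by $w$. -/

import Mathlib

/-- The inclusion `ℚ^d ⊆ ℝ^d`. -/
def rk {d : ℕ} (x : Fin d → ℚ) : Fin d → ℝ := fun i => (x i : ℝ)

open Classical in
/-- Affine dimension of a subset of a real vector space: the dimension of its affine span,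
with the usual convention that the empty set has dimension `-1`. -/
noncomputable def setDim {V : Type*} [AddCommGroup V] [Module ℝ V] (s : Set V) : ℤ :=
  if s = ∅ then -1 else (Module.finrank ℝ (affineSpan ℝ s).direction : ℤ)

/-- A linear functional on `ℝ^d × ℝ` is lower if it is positive on `(0, 1)`. -/
def IsLowerFn {d : ℕ} (u : ((Fin d → ℝ) × ℝ) →ₗ[ℝ] ℝ) : Prop := 0 < u (0, 1)

/-- The exposed lower face of `Q` at the functional `u`: the set of minimizers of `u` on `Q`. -/
def lowerFace {d : ℕ} (Q : Set ((Fin d → ℝ) × ℝ)) (u : ((Fin d → ℝ) × ℝ) →ₗ[ℝ] ℝ) :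
    Set ((Fin d → ℝ) × ℝ) := {z ∈ Q | ∀ y ∈ Q, u z ≤ u y}

/-- A lower facet of `Q`: an exposed lower face of `Q` at a lower functional whose dimension
equals the dimension of `convexHull (π '' Q)`. -/
def IsLowerFacet {d : ℕ} (Q F : Set ((Fin d → ℝ) × ℝ)) : Prop :=
  ∃ u, IsLowerFn u ∧ F = lowerFace Q u ∧
    setDim F = setDim (convexHull ℝ (Prod.fst '' Q))

/-- A simplex: the convex hull of an affinely independent finite set. -/
def IsSimplex {V : Type*} [AddCommGroup V] [Module ℝ V] (s : Set V) : Prop :=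
  ∃ t : Finset V, AffineIndependent ℝ (fun x : (t : Set V) => x.1) ∧ s = convexHull ℝ (t : Set V)

/-- The lifted polytope `Q_w` of a finite set `L` of rational points with rational weights.
Only the values of `w` on `L` matter. -/
def liftQ {d : ℕ} (L : Finset (Fin d → ℚ)) (w : (Fin d → ℚ) → ℚ) :
    Set ((Fin d → ℝ) × ℝ) :=
  convexHull ℝ ((fun x => (rk x, (w x : ℝ))) '' (L : Set (Fin d → ℚ)))

/-- The weight `w` induces a regular triangulation of `L`: every lower facet of `Q_w` is a
simplex. -/
def InducesRegularTriangulation {d : ℕ} (L : Finset (Fin d → ℚ)) (w : (Fin d → ℚ) → ℚ) : Prop :=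
  ∀ F, IsLowerFacet (liftQ L w) F → IsSimplex F

/-- The cells induced by `w` on `L`: the projections to `ℝ^d` of the lower facets of `Q_w`.
These are the simplices of the triangulation when `w` induces a regular triangulation. -/
def inducedCells {d : ℕ} (L : Finset (Fin d → ℚ)) (w : (Fin d → ℚ) → ℚ) :
    Set (Set (Fin d → ℝ)) :=
  {T | ∃ F, IsLowerFacet (liftQ L w) F ∧ T = Prod.fst '' F}

section LowerFaces

variable {d : ℕ} {S : Set ((Fin d → ℝ) × ℝ)} {u : ((Fin d → ℝ) × ℝ) →ₗ[ℝ] ℝ}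

theorem lowerFace_subset : lowerFace S u ⊆ S := fun _ h => h.1

theorem lowerFace_nonempty (hS : S.Finite) (hne : S.Nonempty) : (lowerFace S u).Nonempty := by
  obtain ⟨x, hx, hmin⟩ := hS.exists_minimalFor u S hne
  refine ⟨x, hx, fun y hy => ?_⟩
  by_contra hlt
  exact hlt (hmin hy (le_of_not_ge hlt))

theorem apply_eq_of_mem_lowerFace {x y : (Fin d → ℝ) × ℝ} (hx : x ∈ lowerFace S u)
    (hy : y ∈ lowerFace S u) : u x = u y :=
  le_antisymm (hx.2 y hy.1) (hy.2 x hx.1)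

theorem le_apply_of_mem_convexHull {m : ℝ} (h : ∀ y ∈ S, m ≤ u y) {z : (Fin d → ℝ) × ℝ}
    (hz : z ∈ convexHull ℝ S) : m ≤ u z :=
  convexHull_min (t := {z | m ≤ u z}) h (convex_halfSpace_ge u.isLinear m) hz

theorem apply_eq_of_mem_affineSpan {m : ℝ} (h : ∀ y ∈ S, u y = m) {z : (Fin d → ℝ) × ℝ}
    (hz : z ∈ affineSpan ℝ S) : u z = m := by
  refine affineSpan_induction hz h fun c x y z hx hy hz => ?_
  simp [hx, hy, hz]

theorem lowerFace_convexHull (hS : S.Finite) :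
    lowerFace (convexHull ℝ S) u = convexHull ℝ (lowerFace S u) := by
  rcases S.eq_empty_or_nonempty with rfl | hne
  · simp [lowerFace]
  obtain ⟨x₀, hx₀⟩ := lowerFace_nonempty (u := u) hS hne
  apply Set.Subset.antisymm
  · rintro z ⟨hz, hmin⟩
    have hzle : u z ≤ u x₀ := hmin x₀ (subset_convexHull ℝ S hx₀.1)
    lift S to Finset ((Fin d → ℝ) × ℝ) using hS
    obtain ⟨c, hc0, hc1, rfl⟩ := Finset.mem_convexHull'.1 hz
    have hsum : ∑ y ∈ S, c y * (u y - u x₀) ≤ 0 := by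
      have : ∑ y ∈ S, c y * (u y - u x₀) = u (∑ y ∈ S, c y • y) - u x₀ := by
        simp only [mul_sub, Finset.sum_sub_distrib, ← Finset.sum_mul, hc1, map_sum, map_smul,
          smul_eq_mul, one_mul]
      linarith
    have hnn : ∀ y ∈ S, 0 ≤ c y * (u y - u x₀) := fun y hy =>
      mul_nonneg (hc0 y hy) (sub_nonneg.2 (hx₀.2 y hy))
    have hzero := (Finset.sum_eq_zero_iff_of_nonneg hnn).1
      (le_antisymm hsum (Finset.sum_nonneg hnn))
    classical
    obtain ⟨T, hT⟩ : ∃ T : Finset ((Fin d → ℝ) × ℝ), T = S.filter (fun y => u y = u x₀) := ⟨_, rfl⟩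
    have hTS : T ⊆ S := hT ▸ Finset.filter_subset _ S
    have hout : ∀ y ∈ S, y ∉ T → c y = 0 := by
      intro y hy hyn
      rcases mul_eq_zero.1 (hzero y hy) with h | h
      · exact h
      · exact absurd (hT ▸ Finset.mem_filter.2 ⟨hy, sub_eq_zero.1 h⟩) hyn
    have hsmul : ∀ y ∈ S, y ∉ T → c y • y = 0 := fun y hy hyn => by
      rw [hout y hy hyn, zero_smul]
    rw [← Finset.sum_subset hTS hsmul]
    rw [← Finset.sum_subset hTS hout] at hc1
    refine (convex_convexHull ℝ _).sum_mem (fun y hy => hc0 y (hTS hy)) hc1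
      fun y hy => subset_convexHull ℝ _ ?_
    obtain ⟨hyS, hy⟩ := Finset.mem_filter.1 (hT ▸ hy)
    exact ⟨hyS, fun y' hy' => hy.trans_le (hx₀.2 y' hy')⟩
  · intro z hz
    refine ⟨convexHull_mono lowerFace_subset hz, fun y hy => ?_⟩
    have hzx : u z = u x₀ := apply_eq_of_mem_affineSpan
      (fun y hy => apply_eq_of_mem_lowerFace hy hx₀) (convexHull_subset_affineSpan _ hz)
    exact hzx.trans_le (le_apply_of_mem_convexHull hx₀.2 hy)

theorem affineSpan_image_fst (T : Set ((Fin d → ℝ) × ℝ)) :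
    affineSpan ℝ (Prod.fst '' T) =
      (affineSpan ℝ T).map (LinearMap.fst ℝ (Fin d → ℝ) ℝ).toAffineMap := by
  rw [AffineSubspace.map_span]; rfl

theorem finrank_direction_image_fst {m : ℝ} (hu : IsLowerFn u) (h : ∀ y ∈ S, u y = m) :
    Module.finrank ℝ (affineSpan ℝ (Prod.fst '' S)).direction =
      Module.finrank ℝ (affineSpan ℝ S).direction := by
  rw [affineSpan_image_fst, AffineSubspace.map_direction, LinearMap.toAffineMap_linear]
  have hker : (affineSpan ℝ S).direction ≤ LinearMap.ker u := by
    rw [direction_affineSpan, vectorSpan_def, Submodule.span_le]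
    rintro _ ⟨x, hx, y, hy, rfl⟩
    simp [h x hx, h y hy]
  rw [← LinearMap.range_domRestrict]
  refine LinearMap.finrank_range_of_inj (LinearMap.ker_eq_bot.1 (LinearMap.ker_eq_bot'.2 ?_))
  rintro ⟨⟨x, r⟩, hz⟩ hx
  obtain rfl : x = 0 := by simpa using hx
  have h0 : u (r • (0, 1)) = 0 := by simpa using hker hz
  rw [map_smul, smul_eq_mul] at h0
  have hr : r = 0 := (mul_eq_zero.1 h0).resolve_right hu.ne'
  simp [hr]

theorem setDim_convexHull {V : Type*} [AddCommGroup V] [Module ℝ V] (s : Set V) :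
    setDim (convexHull ℝ s) = setDim s := by
  simp only [setDim, convexHull_eq_empty]
  rw [affineSpan_convexHull]

theorem affineSpan_eq_of_setDim_eq {V : Type*} [AddCommGroup V] [Module ℝ V]
    [FiniteDimensional ℝ V] {s t : Set V} (hst : s ⊆ t) (h : setDim s = setDim t) :
    affineSpan ℝ s = affineSpan ℝ t := by
  rcases s.eq_empty_or_nonempty with rfl | hs
  · rcases t.eq_empty_or_nonempty with rfl | ht
    · rfl
    · simp only [setDim, ht.ne_empty, if_true, if_false] at h
      omega
  · have ht := hs.mono hst
    simp only [setDim, hs.ne_empty, ht.ne_empty, if_false, Nat.cast_inj] at h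
    exact AffineSubspace.eq_of_direction_eq_of_nonempty_of_le
      (Submodule.eq_of_le_of_finrank_eq (AffineSubspace.direction_le (affineSpan_mono ℝ hst)) h)
      ((affineSpan_nonempty ℝ).2 hs) (affineSpan_mono ℝ hst)

theorem setDim_lowerFace_eq_iff (hS : S.Finite) (hne : S.Nonempty) (hu : IsLowerFn u) :
    setDim (lowerFace (convexHull ℝ S) u) = setDim (convexHull ℝ (Prod.fst '' convexHull ℝ S)) ↔
      affineSpan ℝ (Prod.fst '' lowerFace S u) = affineSpan ℝ (Prod.fst '' S) := by
  obtain ⟨x₀, hx₀⟩ := lowerFace_nonempty (u := u) hS hne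
  have himg : Prod.fst '' convexHull ℝ S = convexHull ℝ (Prod.fst '' S) :=
    (LinearMap.fst ℝ (Fin d → ℝ) ℝ).image_convexHull S
  have hF : setDim (lowerFace S u) = setDim (Prod.fst '' lowerFace S u) := by
    have hn : (lowerFace S u).Nonempty := ⟨x₀, hx₀⟩
    simp only [setDim, hn.ne_empty, (hn.image Prod.fst).ne_empty, if_false]
    rw [finrank_direction_image_fst hu fun y hy => apply_eq_of_mem_lowerFace hy hx₀]
  rw [lowerFace_convexHull hS, himg, setDim_convexHull, setDim_convexHull, setDim_convexHull, hF]
  refine ⟨affineSpan_eq_of_setDim_eq (Set.image_mono lowerFace_subset), fun h => ?_⟩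
  have hn : (Prod.fst '' lowerFace S u).Nonempty := ⟨_, _, hx₀, rfl⟩
  simp only [setDim, hn.ne_empty, (hne.image Prod.fst).ne_empty, if_false]
  rw [h]

theorem isLowerFacet_convexHull_iff (hS : S.Finite) (hne : S.Nonempty)
    {F : Set ((Fin d → ℝ) × ℝ)} :
    IsLowerFacet (convexHull ℝ S) F ↔ ∃ u, IsLowerFn u ∧ F = convexHull ℝ (lowerFace S u) ∧
      affineSpan ℝ (Prod.fst '' lowerFace S u) = affineSpan ℝ (Prod.fst '' S) := by
  constructor
  · rintro ⟨u, hu, rfl, h⟩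
    exact ⟨u, hu, lowerFace_convexHull hS, (setDim_lowerFace_eq_iff hS hne hu).1 h⟩
  · rintro ⟨u, hu, rfl, h⟩
    exact ⟨u, hu, (lowerFace_convexHull hS).symm, by
      rw [← lowerFace_convexHull hS]; exact (setDim_lowerFace_eq_iff hS hne hu).2 h⟩

/-- An affine subspace not containing a point is separated from it by a linear functional. -/
theorem exists_linear_lt_of_notMem {V : Type*} [AddCommGroup V] [Module ℝ V]
    {A : AffineSubspace ℝ V} {a x : V} (ha : a ∈ A) (hx : x ∉ A) :
    ∃ v : V →ₗ[ℝ] ℝ, (∀ y ∈ A, v y = v a) ∧ v x < v a := by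
  have hxa : x - a ∉ A.direction := fun h => hx (by
    simpa using AffineSubspace.vadd_mem_of_mem_direction h ha)
  obtain ⟨f, hf, hker⟩ := Submodule.exists_le_ker_of_notMem hxa
  have key : ∀ y ∈ A, f y = f a := fun y hy => by
    have := hker (AffineSubspace.vsub_mem_direction hy ha)
    simpa [sub_eq_zero] using this
  rw [map_sub, sub_ne_zero] at hf
  rcases lt_or_gt_of_ne hf with h | h
  · exact ⟨f, key, h⟩
  · exact ⟨-f, fun y hy => by simp [key y hy], by simpa using h⟩

/-- Tilting a lower functional until its face acquires a new point. -/
theorem exists_lowerFace_ssubset (hS : S.Finite) (hne : S.Nonempty) (hu : IsLowerFn u)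
    (h : affineSpan ℝ (Prod.fst '' lowerFace S u) ≠ affineSpan ℝ (Prod.fst '' S)) :
    ∃ u', IsLowerFn u' ∧ lowerFace S u ⊂ lowerFace S u' := by
  obtain ⟨a, ha⟩ := lowerFace_nonempty (u := u) hS hne
  have hx : ∃ x ∈ S, x.1 ∉ affineSpan ℝ (Prod.fst '' lowerFace S u) := by
    by_contra! hcon
    refine h (le_antisymm (affineSpan_mono ℝ (Set.image_mono lowerFace_subset)) ?_)
    rw [affineSpan_le]
    rintro _ ⟨x, hx, rfl⟩
    exact hcon x hx
  obtain ⟨x, hxS, hx⟩ := hx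
  obtain ⟨v, hv, hvx⟩ := exists_linear_lt_of_notMem
    (subset_affineSpan ℝ _ (Set.mem_image_of_mem Prod.fst ha)) hx
  have hvF : ∀ y ∈ lowerFace S u, v y.1 = v a.1 := fun y hy =>
    hv _ (subset_affineSpan ℝ _ (Set.mem_image_of_mem Prod.fst hy))
  obtain ⟨y, ⟨hyS, hyv⟩, hymin⟩ :=
    (hS.subset (Set.sep_subset S fun y => v y.1 < v a.1)).exists_minimalFor
      (fun y => (u y - u a) / (v a.1 - v y.1)) _ ⟨x, hxS, hvx⟩
  set t := (u y - u a) / (v a.1 - v y.1)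
  have ht0 : 0 ≤ t := div_nonneg (sub_nonneg.2 (ha.2 y hyS)) (sub_nonneg.2 hyv.le)
  have happ : ∀ z, (u + t • v ∘ₗ LinearMap.fst ℝ (Fin d → ℝ) ℝ) z = u z + t * v z.1 := fun z => by
    simp
  have hle : ∀ z ∈ S, u a + t * v a.1 ≤ u z + t * v z.1 := by
    intro z hz
    rcases lt_or_ge (v z.1) (v a.1) with hlt | hge
    · have htz : t ≤ (u z - u a) / (v a.1 - v z.1) := by
        by_contra hcon
        exact hcon (hymin ⟨hz, hlt⟩ (le_of_not_ge hcon))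
      rw [le_div_iff₀ (sub_pos.2 hlt)] at htz
      linarith
    · have := ha.2 z hz
      have := mul_le_mul_of_nonneg_left hge ht0
      linarith
  have hy : u y + t * v y.1 = u a + t * v a.1 := by
    have : t * (v a.1 - v y.1) = u y - u a := div_mul_cancel₀ _ (sub_pos.2 hyv).ne'
    linarith
  refine ⟨u + t • v ∘ₗ LinearMap.fst ℝ (Fin d → ℝ) ℝ, ?_, ?_⟩
  · rw [IsLowerFn, happ]
    simpa [IsLowerFn] using hu
  · rw [Set.ssubset_iff_of_subset]
    · refine ⟨y, ⟨hyS, fun z hz => ?_⟩, fun hyF => hyv.ne (hvF y hyF)⟩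
      rw [happ, happ, hy]
      exact hle z hz
    · refine fun z hz => ⟨hz.1, fun z' hz' => ?_⟩
      rw [happ, happ, hvF z hz, apply_eq_of_mem_lowerFace hz ha]
      exact hle z' hz'

theorem exists_lowerFacet_superset (hS : S.Finite) (hne : S.Nonempty) (hu : IsLowerFn u) :
    ∃ u', IsLowerFn u' ∧ lowerFace S u ⊆ lowerFace S u' ∧
      affineSpan ℝ (Prod.fst '' lowerFace S u') = affineSpan ℝ (Prod.fst '' S) := by
  have hfin : {T | ∃ u', IsLowerFn u' ∧ T = lowerFace S u'}.Finite :=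
    hS.finite_subsets.subset (by rintro _ ⟨u', -, rfl⟩; exact lowerFace_subset)
  obtain ⟨T, hT, ⟨u', hu', rfl⟩, hmax⟩ := hfin.exists_le_maximal ⟨u, hu, rfl⟩
  refine ⟨u', hu', hT, ?_⟩
  by_contra hcon
  obtain ⟨u'', hu'', hss⟩ := exists_lowerFace_ssubset hS hne hu' hcon
  exact hss.2 (hmax ⟨u'', hu'', rfl⟩ hss.1)

theorem IsSimplex.lowerFace {Q : Set ((Fin d → ℝ) × ℝ)} (hQ : IsSimplex Q)
    (u : ((Fin d → ℝ) × ℝ) →ₗ[ℝ] ℝ) : IsSimplex (lowerFace Q u) := by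
  obtain ⟨t, ht, rfl⟩ := hQ
  have hfin : (_root_.lowerFace (t : Set ((Fin d → ℝ) × ℝ)) u).Finite :=
    t.finite_toSet.subset lowerFace_subset
  refine ⟨hfin.toFinset, ?_, ?_⟩
  · rw [hfin.coe_toFinset]
    exact ht.mono lowerFace_subset
  · rw [hfin.coe_toFinset, lowerFace_convexHull t.finite_toSet]

theorem IsSimplex.convexHull_insert {V : Type*} [AddCommGroup V] [Module ℝ V] {T : Set V} {p : V}
    (hT : IsSimplex (convexHull ℝ T)) (hp : p ∉ affineSpan ℝ T) :
    IsSimplex (convexHull ℝ (insert p T)) := by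
  classical
  obtain ⟨t, ht, hTt⟩ := hT
  refine ⟨insert p t, ?_, ?_⟩
  · rw [← affineSpan_convexHull, hTt, affineSpan_convexHull] at hp
    rw [Finset.coe_insert]
    refine AffineIndependent.affineIndependent_of_notMem_span
      (i := (⟨p, Set.mem_insert p _⟩ : (insert p (t : Set V) : Set V))) ?_ fun hmem => hp ?_
    · have hmem : ∀ x : {y : (insert p (t : Set V) : Set V) // y ≠ ⟨p, Set.mem_insert p _⟩},
          (x : V) ∈ (t : Set V) := fun x =>
        x.1.2.resolve_left fun h => x.2 (Subtype.ext h)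
      exact ht.comp_embedding ⟨fun x => ⟨x.1.1, hmem x⟩, fun x y hxy =>
        Subtype.ext (Subtype.ext (Subtype.mk.inj hxy))⟩
    · refine affineSpan_mono ℝ ?_ hmem
      rintro _ ⟨x, hx, rfl⟩
      exact x.2.resolve_left fun h => hx (Subtype.ext h)
  · rw [Finset.coe_insert, Set.insert_eq, Set.insert_eq, ← convexHull_convexHull_union_right, hTt,
      convexHull_convexHull_union_right]

/-- Every lower face is a simplex as soon as the lower facets are. -/
theorem isSimplex_lowerFace (hS : S.Finite) (hne : S.Nonempty)
    (hsimp : ∀ F, IsLowerFacet (convexHull ℝ S) F → IsSimplex F) (hu : IsLowerFn u) :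
    IsSimplex (convexHull ℝ (lowerFace S u)) := by
  obtain ⟨u', hu', hsub, hspan⟩ := exists_lowerFacet_superset hS hne hu
  have h := (hsimp _ ((isLowerFacet_convexHull_iff hS hne).2 ⟨u', hu', rfl, hspan⟩)).lowerFace u
  rw [lowerFace_convexHull (hS.subset lowerFace_subset)] at h
  obtain ⟨a, ha⟩ := lowerFace_nonempty (u := u) hS hne
  convert h using 2
  ext z
  exact ⟨fun hz => ⟨hsub hz, fun y hy => hz.2 y hy.1⟩,
    fun hz => ⟨hz.1.1, fun y hy => (hz.2 a (hsub ha)).trans (ha.2 y hy)⟩⟩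

/-- Above a point of the affine span, all sufficiently high points lie strictly above all lower
facets. -/
theorem exists_height_above_lowerFacets (hS : S.Finite) {p : Fin d → ℝ}
    (hp : p ∈ affineSpan ℝ (Prod.fst '' S)) :
    ∃ h₀ : ℝ, ∀ h, h₀ < h → ∀ u, IsLowerFn u →
      affineSpan ℝ (Prod.fst '' lowerFace S u) = affineSpan ℝ (Prod.fst '' S) →
      ∀ z ∈ lowerFace S u, u z < u (p, h) := by
  have hex : ∀ T : Set ((Fin d → ℝ) × ℝ), ∃ r : ℝ,
      p ∈ affineSpan ℝ (Prod.fst '' T) → (p, r) ∈ affineSpan ℝ T := by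
    intro T
    by_cases hT : p ∈ affineSpan ℝ (Prod.fst '' T)
    · rw [affineSpan_image_fst] at hT
      obtain ⟨⟨q, r⟩, hz, rfl⟩ := hT
      exact ⟨r, fun _ => hz⟩
    · exact ⟨0, fun h => absurd h hT⟩
  choose r hr using hex
  obtain ⟨h₀, hh₀⟩ := (hS.finite_subsets.image r).bddAbove
  refine ⟨h₀, fun h hh u hu hspan z hz => ?_⟩
  have hmem := hr (lowerFace S u) (hspan ▸ hp)
  have hval := apply_eq_of_mem_affineSpan (fun y hy => apply_eq_of_mem_lowerFace hy hz) hmem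
  have hlt : r (lowerFace S u) < h :=
    (hh₀ (Set.mem_image_of_mem r
      (show lowerFace S u ∈ {T | T ⊆ S} from lowerFace_subset))).trans_lt hh
  have hdiff : u (p, h) - u (p, r (lowerFace S u)) = (h - r (lowerFace S u)) * u (0, 1) := by
    rw [← map_sub, ← smul_eq_mul, ← map_smul]
    simp
  have := mul_pos (sub_pos.2 hlt) hu
  linarith

theorem lowerFace_insert_of_lt {P z : (Fin d → ℝ) × ℝ} (hz : z ∈ lowerFace S u)
    (h : u z < u P) : lowerFace (insert P S) u = lowerFace S u := by
  ext y
  constructor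
  · rintro ⟨rfl | hy, hmin⟩
    · exact absurd (hmin z (Or.inr hz.1)) (not_le.2 h)
    · exact ⟨hy, fun x hx => hmin x (Or.inr hx)⟩
  · refine fun hy => ⟨Or.inr hy.1, ?_⟩
    rintro x (rfl | hx)
    · exact (apply_eq_of_mem_lowerFace hy hz).trans_le h.le
    · exact hy.2 x hx

theorem lowerFace_insert_of_eq {P z : (Fin d → ℝ) × ℝ} (hz : z ∈ lowerFace S u)
    (h : u P = u z) : lowerFace (insert P S) u = insert P (lowerFace S u) := by
  ext y
  constructor
  · rintro ⟨rfl | hy, hmin⟩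
    · exact Or.inl rfl
    · exact Or.inr ⟨hy, fun x hx => hmin x (Or.inr hx)⟩
  · rintro (rfl | hy)
    · refine ⟨Or.inl rfl, ?_⟩
      rintro x (rfl | hx)
      · exact le_rfl
      · exact h.trans_le (hz.2 x hx)
    · refine ⟨Or.inr hy.1, ?_⟩
      rintro x (rfl | hx)
      · exact ((apply_eq_of_mem_lowerFace hy hz).trans h.symm).le
      · exact hy.2 x hx

theorem lowerFace_insert_of_gt {P z : (Fin d → ℝ) × ℝ} (hz : z ∈ lowerFace S u)
    (h : u P < u z) : lowerFace (insert P S) u = {P} := by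
  ext y
  constructor
  · rintro ⟨rfl | hy, hmin⟩
    · rfl
    · exact absurd ((hz.2 y hy).trans (hmin P (Or.inl rfl))) (not_le.2 h)
  · rintro rfl
    refine ⟨Or.inl rfl, ?_⟩
    rintro x (rfl | hx)
    · exact le_rfl
    · exact h.le.trans (hz.2 x hx)

/-- Placing a point high enough above a lifted configuration keeps all lower facets, and keeps
them simplices. -/
theorem exists_height_placing (hS : S.Finite) (hne : S.Nonempty) {p : Fin d → ℝ}
    (hp : p ∈ affineSpan ℝ (Prod.fst '' S))
    (hsimp : ∀ F, IsLowerFacet (convexHull ℝ S) F → IsSimplex F) :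
    ∃ h₀ : ℝ, ∀ h, h₀ < h →
      (∀ F, IsLowerFacet (convexHull ℝ (insert (p, h) S)) F → IsSimplex F) ∧
      ∀ F, IsLowerFacet (convexHull ℝ S) F → IsLowerFacet (convexHull ℝ (insert (p, h) S)) F := by
  obtain ⟨h₀, hh₀⟩ := exists_height_above_lowerFacets hS hp
  refine ⟨h₀, fun h hh => ?_⟩
  have hS' : (insert (p, h) S).Finite := hS.insert _
  have hne' : (insert (p, h) S).Nonempty := Set.insert_nonempty _ _
  have hspan' : affineSpan ℝ (Prod.fst '' insert (p, h) S) = affineSpan ℝ (Prod.fst '' S) := by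
    rw [Set.image_insert_eq]
    exact affineSpan_insert_eq_affineSpan ℝ hp
  constructor
  · intro F hF
    obtain ⟨u, hu, rfl, hspan⟩ := (isLowerFacet_convexHull_iff hS' hne').1 hF
    rw [hspan'] at hspan
    obtain ⟨a, ha⟩ := lowerFace_nonempty (u := u) hS hne
    have hface := isSimplex_lowerFace hS hne hsimp hu
    rcases lt_trichotomy (u (p, h)) (u a) with hlt | heq | hgt
    · rw [lowerFace_insert_of_gt ha hlt]
      exact ⟨{(p, h)}, by simpa using affineIndependent_of_subsingleton ℝ _, by simp⟩
    · rw [lowerFace_insert_of_eq ha heq] at hspan ⊢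
      refine hface.convexHull_insert fun hmem => ?_
      have hpm : p ∈ affineSpan ℝ (Prod.fst '' lowerFace S u) := by
        rw [affineSpan_image_fst]
        exact ⟨_, hmem, rfl⟩
      rw [Set.image_insert_eq, affineSpan_insert_eq_affineSpan ℝ hpm] at hspan
      exact (hh₀ h hh u hu hspan a ha).ne' heq
    · rwa [lowerFace_insert_of_lt ha hgt]
  · intro F hF
    obtain ⟨u, hu, rfl, hspan⟩ := (isLowerFacet_convexHull_iff hS hne).1 hF
    obtain ⟨a, ha⟩ := lowerFace_nonempty (u := u) hS hne
    have heq := lowerFace_insert_of_lt ha (hh₀ h hh u hu hspan a ha)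
    exact (isLowerFacet_convexHull_iff hS' hne').2 ⟨u, hu, by rw [heq], by rw [heq, hspan, hspan']⟩

end LowerFaces

theorem fst_image_lift {d : ℕ} (L : Set (Fin d → ℚ)) (w : (Fin d → ℚ) → ℚ) :
    Prod.fst '' ((fun x => (rk x, (w x : ℝ))) '' L) = rk '' L := by
  rw [Set.image_image]

open Classical in
theorem exists_regular_extension_insert {d : ℕ} {L : Finset (Fin d → ℚ)} (hne : L.Nonempty)
    {p : Fin d → ℚ} (hpL : p ∉ L) (hp : rk p ∈ affineSpan ℝ (rk '' (L : Set (Fin d → ℚ))))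
    {w : (Fin d → ℚ) → ℚ} (hreg : InducesRegularTriangulation L w) :
    ∃ w' : (Fin d → ℚ) → ℚ, 0 ≤ w' p ∧ (∀ x ∈ L, w' x = w x) ∧
      InducesRegularTriangulation (insert p L) w' ∧
      ∀ F, IsLowerFacet (liftQ L w) F → IsLowerFacet (liftQ (insert p L) w') F := by
  rw [← fst_image_lift _ w] at hp
  obtain ⟨h₀, hh₀⟩ := exists_height_placing (L.finite_toSet.image _) (hne.to_set.image _) hp hreg
  obtain ⟨n, hn⟩ := exists_nat_gt h₀
  have hag : ∀ x ∈ L, Function.update w p (n : ℚ) x = w x := fun x hx =>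
    Function.update_of_ne (ne_of_mem_of_not_mem hx hpL) _ _
  have hQ : liftQ (insert p L) (Function.update w p (n : ℚ)) =
      convexHull ℝ (insert (rk p, (n : ℝ)) ((fun x => (rk x, (w x : ℝ))) '' (L : Set _))) := by
    unfold liftQ
    rw [Finset.coe_insert, Set.image_insert_eq, Function.update_self, Rat.cast_natCast]
    congr 2
    exact Set.image_congr fun x hx => by rw [hag x hx]
  refine ⟨Function.update w p (n : ℚ), by simp, hag, ?_, ?_⟩
  · rw [InducesRegularTriangulation, hQ]
    exact (hh₀ n hn).1
  · rw [hQ]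
    exact (hh₀ n hn).2

theorem exists_regular_extension_union {d : ℕ} {L₀ : Finset (Fin d → ℚ)} (hne : L₀.Nonempty)
    {w₀ : (Fin d → ℚ) → ℚ} (hw₀ : ∀ x ∈ L₀, 0 ≤ w₀ x)
    (hreg : InducesRegularTriangulation L₀ w₀) [DecidableEq (Fin d → ℚ)] (M : Finset (Fin d → ℚ))
    (hM : ∀ x ∈ M, rk x ∈ affineSpan ℝ (rk '' (L₀ : Set (Fin d → ℚ)))) :
    ∃ w : (Fin d → ℚ) → ℚ, (∀ x ∈ M ∪ L₀, 0 ≤ w x) ∧ (∀ x ∈ L₀, w x = w₀ x) ∧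
      InducesRegularTriangulation (M ∪ L₀) w ∧
      ∀ F, IsLowerFacet (liftQ L₀ w₀) F → IsLowerFacet (liftQ (M ∪ L₀) w) F := by
  induction M using Finset.induction_on with
  | empty => exact ⟨w₀, by simpa using hw₀, fun _ _ => rfl, by simpa using hreg, by simp⟩
  | insert p M hpM ih =>
    obtain ⟨w, hw0, hww, hwr, hwF⟩ := ih fun x hx => hM x (Finset.mem_insert_of_mem hx)
    rw [Finset.insert_union]
    by_cases hp : p ∈ M ∪ L₀
    · rw [Finset.insert_eq_of_mem hp]
      exact ⟨w, hw0, hww, hwr, hwF⟩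
    · have hpspan : rk p ∈ affineSpan ℝ (rk '' ((M ∪ L₀ : Finset _) : Set (Fin d → ℚ))) :=
        affineSpan_mono ℝ (Set.image_mono (by simp)) (hM p (Finset.mem_insert_self p M))
      obtain ⟨w', hp0, hag, hr', hF'⟩ := exists_regular_extension_insert
        (hne.mono Finset.subset_union_right) hp hpspan hwr
      refine ⟨w', fun x hx => ?_, fun x hx => ?_, ?_, fun F hF => ?_⟩
      · rcases Finset.mem_insert.1 hx with rfl | hx
        · exact hp0
        · rw [hag x hx]
          exact hw0 x hx
      · rw [hag x (Finset.mem_union_right M hx), hww x hx]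
      · convert hr'
      · convert hF' F (hwF F hF)

/-- A regular triangulation of `L₀ ⊆ L ⊆ ℚ^d` induced by a nonnegative rational weight function
`w₀` extends to a regular triangulation of `L` induced by a nonnegative rational weight function
`w` extending `w₀`, in such a way that every lower facet of `Q_{w₀}` is a lower facet of `Q_w`;
in particular every simplex of the triangulation of `L₀` is a simplex of the triangulation of
`L`. -/
theorem stmt0 (d : ℕ) (L₀ L : Finset (Fin d → ℚ)) (hsub : L₀ ⊆ L)
    (hdim : setDim (convexHull ℝ (rk '' (L₀ : Set (Fin d → ℚ)))) =
            setDim (convexHull ℝ (rk '' (L : Set (Fin d → ℚ)))))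
    (w₀ : (Fin d → ℚ) → ℚ) (hw₀ : ∀ x ∈ L₀, 0 ≤ w₀ x)
    (hreg : InducesRegularTriangulation L₀ w₀) :
    ∃ w : (Fin d → ℚ) → ℚ,
      (∀ x ∈ L, 0 ≤ w x) ∧
      (∀ x ∈ L₀, w x = w₀ x) ∧
      InducesRegularTriangulation L w ∧
      (∀ F, IsLowerFacet (liftQ L₀ w₀) F → IsLowerFacet (liftQ L w) F) ∧
      inducedCells L₀ w₀ ⊆ inducedCells L w := by
  classical
  rw [setDim_convexHull, setDim_convexHull] at hdim
  have hspan := affineSpan_eq_of_setDim_eq (Set.image_mono (Finset.coe_subset.2 hsub)) hdim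
  have hmain : ∃ w : (Fin d → ℚ) → ℚ, (∀ x ∈ L, 0 ≤ w x) ∧ (∀ x ∈ L₀, w x = w₀ x) ∧
      InducesRegularTriangulation L w ∧
      ∀ F, IsLowerFacet (liftQ L₀ w₀) F → IsLowerFacet (liftQ L w) F := by
    rcases L₀.eq_empty_or_nonempty with rfl | hne
    · have hL : L = ∅ := by
        rw [Finset.coe_empty, Set.image_empty, AffineSubspace.span_empty, eq_comm,
          affineSpan_eq_bot] at hspan
        simpa using hspan
      subst hL
      exact ⟨w₀, hw₀, fun _ _ => rfl, hreg, fun _ h => h⟩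
    · have := exists_regular_extension_union hne hw₀ hreg L fun x hx =>
        hspan ▸ subset_affineSpan ℝ _ (Set.mem_image_of_mem rk hx)
      rwa [Finset.union_eq_left.2 hsub] at this
  obtain ⟨w, hw0, hww, hr, hF⟩ := hmain
  refine ⟨w, hw0, hww, hr, hF, ?_⟩
  rintro _ ⟨F, hFf, rfl⟩
  exact ⟨F, hF F hFf, rfl⟩
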